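/- Let p be a prime and let n ≥ 1 and r ≥ 1 be integers. For g ∈ GL_{2n}(ℤ_p) the following are equivalent: (i) g is upper triangular mod p^r; (ii) there exist h₁, h₂ ∈ GL_n(ℤ_p), units y_1, …, y_n ∈ ℤ_p^×, and an upper triangular b ∈ GL_{2n}(ℤ_p), such that h₁ ≡ diag(y_1, …, y_n) mod p^r, h₂ ≡ diag(y_n, …, y_1) mod p^r, and g = u^{-1}·diag(h₁,h₂)·u·b. -/

import Mathlib

/- We index `GL_{2n}` by `Fin n ⊕ Fin n` (two blocks of size `n`), with `ordIdx`
giving the usual linear ordering of the `2n` coordinates. -/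

/-- The position of an index of `Fin n ⊕ Fin n` in the usual ordering `0, …, 2n−1`. -/
def ordIdx (n : ℕ) : Fin n ⊕ Fin n → ℕ :=
  Sum.elim (fun a => (a : ℕ)) (fun a => n + (a : ℕ))

/-- The `n × n` antidiagonal matrix `w_n` (0-based: `w i j = 1` iff `i + j + 1 = n`). -/
noncomputable def wMat (p n : ℕ) [Fact p.Prime] : Matrix (Fin n) (Fin n) ℤ_[p] :=
  fun i j => if (i : ℕ) + (j : ℕ) + 1 = n then 1 else 0

/-- The element `u = [[1_n, 0], [w_n, 1_n]] ∈ GL_{2n}(ℤ_p)`. -/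
noncomputable def uMat (p n : ℕ) [Fact p.Prime] :
    Matrix (Fin n ⊕ Fin n) (Fin n ⊕ Fin n) ℤ_[p] :=
  Matrix.fromBlocks 1 0 (wMat p n) 1

/-- The block diagonal matrix `diag(h₁, h₂)`. -/
noncomputable def blockDiag (p n : ℕ) [Fact p.Prime]
    (h₁ h₂ : Matrix (Fin n) (Fin n) ℤ_[p]) :
    Matrix (Fin n ⊕ Fin n) (Fin n ⊕ Fin n) ℤ_[p] :=
  Matrix.fromBlocks h₁ 0 0 h₂

open Matrix in
theorem lu_aux {R S : Type*} [CommRing R] [CommRing S] (φ : R →+* S) [IsLocalHom φ] :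
    ∀ (n : ℕ) (Q : Matrix (Fin n) (Fin n) R), (∀ i j, j < i → φ (Q i j) = 0) →
      (∀ i, IsUnit (Q i i)) →
      ∃ L U : Matrix (Fin n) (Fin n) R, Q = L * U ∧ (∀ i j, i < j → L i j = 0) ∧
        φ.mapMatrix L = 1 ∧ (∀ i j, j < i → U i j = 0) := by
  intro n
  induction n with
  | zero =>
    intro Q _ _
    exact ⟨1, 1, Subsingleton.elim _ _, fun i => i.elim0, Subsingleton.elim _ _, fun i => i.elim0⟩
  | succ n ih =>
    intro Q hQ hd
    obtain ⟨q, hq⟩ := hd 0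
    obtain ⟨L, U, h, hL, hL1, hU⟩ := ih
      (Matrix.of fun i j => Q i.succ j.succ - Q i.succ 0 * (↑q⁻¹ : R) * Q 0 j.succ)
      (by
        intro i j hij
        simp only [Matrix.of_apply, map_sub, map_mul, hQ i.succ 0 (Fin.succ_pos i),
          hQ i.succ j.succ (Fin.succ_lt_succ_iff.2 hij)]
        simp)
      (by
        intro i
        apply isUnit_of_map_unit φ
        simp only [Matrix.of_apply, map_sub, map_mul, hQ i.succ 0 (Fin.succ_pos i)]
        simpa using (hd i.succ).map φ)
    refine ⟨Matrix.of fun i j => Fin.cases (Fin.cases 1 (fun _ => 0) j)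
        (fun i => Fin.cases (Q i.succ 0 * (↑q⁻¹ : R)) (fun j => L i j) j) i,
      Matrix.of fun i j => Fin.cases (Q 0 j) (fun i => Fin.cases 0 (fun j => U i j) j) i, ?_, ?_, ?_, ?_⟩
    · ext i j
      rw [Matrix.mul_apply, Fin.sum_univ_succ]
      refine Fin.cases ?_ (fun i => ?_) i
      · simp
      · refine Fin.cases ?_ (fun j => ?_) j
        · simp [← hq, mul_assoc]
        · have := congrFun (congrFun h i) j
          rw [Matrix.mul_apply] at this
          simp only [Matrix.of_apply, Fin.cases_succ, Fin.cases_zero] at this ⊢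
          rw [← this]; ring
    · intro i j
      refine Fin.cases ?_ (fun i => ?_) i <;> refine Fin.cases ?_ (fun j => ?_) j
      · simp
      · simp
      · simp
      · intro hij
        simpa using hL i j (Fin.succ_lt_succ_iff.1 hij)
    · ext i j
      refine Fin.cases ?_ (fun i => ?_) i <;> refine Fin.cases ?_ (fun j => ?_) j
      · simp
      · simp [Matrix.one_apply, (Fin.succ_ne_zero j).symm]
      · simp [hQ i.succ 0 (Fin.succ_pos i), Matrix.one_apply]
      · have := congrFun (congrFun hL1 i) j
        simpa [Matrix.one_apply] using this
    · intro i j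
      refine Fin.cases ?_ (fun i => ?_) i <;> refine Fin.cases ?_ (fun j => ?_) j
      · simp
      · simp
      · simp
      · intro hij
        simpa using hU i j (Fin.succ_lt_succ_iff.1 hij)

open Matrix in
theorem lu_gl {R S : Type*} [CommRing R] [CommRing S] (φ : R →+* S) [IsLocalHom φ]
    (n : ℕ) (Q : GL (Fin n) R) (hQ : ∀ i j, j < i → φ ((Q : Matrix (Fin n) (Fin n) R) i j) = 0) :
      ∃ L U : GL (Fin n) R, Q = L * U ∧ (∀ i j, i < j → (L : Matrix (Fin n) (Fin n) R) i j = 0) ∧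
        φ.mapMatrix (L : Matrix (Fin n) (Fin n) R) = 1 ∧ (∀ i j, j < i → (U : Matrix (Fin n) (Fin n) R) i j = 0) := by
  have hdet : IsUnit (Q : Matrix (Fin n) (Fin n) R).det := (Matrix.isUnit_iff_isUnit_det _).1 Q.isUnit
  have h1 := hdet.map φ
  rw [RingHom.map_det, Matrix.det_of_isUpperTriangular (by
    intro i j hij
    exact hQ i j hij)] at h1
  obtain ⟨L, U, h, hL, hL1, hU⟩ := lu_aux φ n Q hQ (fun i => by
    apply isUnit_of_map_unit φ
    have := isUnit_of_dvd_unit (Finset.dvd_prod_of_mem _ (Finset.mem_univ i)) h1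
    simpa using this)
  rw [h, Matrix.det_mul, IsUnit.mul_iff] at hdet
  obtain ⟨L, rfl⟩ := (Matrix.isUnit_iff_isUnit_det _).2 hdet.1
  obtain ⟨U, rfl⟩ := (Matrix.isUnit_iff_isUnit_det _).2 hdet.2
  exact ⟨L, U, Units.ext h, hL, hL1, hU⟩

theorem upper_inv {R : Type*} [CommRing R] {n : ℕ} (t : GL (Fin n) R)
    (ht : ∀ i j, j < i → (t : Matrix (Fin n) (Fin n) R) i j = 0) :
    ∀ i j, j < i → ((t⁻¹ : GL (Fin n) R) : Matrix (Fin n) (Fin n) R) i j = 0 := by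
  have hb : Matrix.BlockTriangular (t : Matrix (Fin n) (Fin n) R) id := fun i j h => ht i j h
  letI : Invertible (t : Matrix (Fin n) (Fin n) R) := t.isUnit.invertible
  have := Matrix.blockTriangular_inv_of_blockTriangular hb
  intro i j h
  rw [Matrix.coe_units_inv]
  exact this h

theorem upper_mul {R : Type*} [CommRing R] {n : ℕ} (s t : Matrix (Fin n) (Fin n) R)
    (hs : ∀ i j, j < i → s i j = 0) (ht : ∀ i j, j < i → t i j = 0) :
    ∀ i j, j < i → (s * t) i j = 0 := by
  have hb : Matrix.BlockTriangular s id := fun i j h => hs i j h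
  have hc : Matrix.BlockTriangular t id := fun i j h => ht i j h
  intro i j h
  exact hb.mul hc h

theorem map_inv_one {R S : Type*} [CommRing R] [CommRing S] (φ : R →+* S) {n : ℕ}
    (a : GL (Fin n) R) (h : φ.mapMatrix (a : Matrix (Fin n) (Fin n) R) = 1) :
    φ.mapMatrix ((a⁻¹ : GL (Fin n) R) : Matrix (Fin n) (Fin n) R) = 1 := by
  have : φ.mapMatrix ((a * a⁻¹ : GL (Fin n) R) : Matrix (Fin n) (Fin n) R) = 1 := by simp
  rwa [Units.val_mul, map_mul, h, one_mul] at this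

theorem unit_of_map {R S : Type*} [CommRing R] [CommRing S] (φ : R →+* S) [IsLocalHom φ] {n : ℕ}
    (a : Matrix (Fin n) (Fin n) R) (h : IsUnit (φ.mapMatrix a)) : IsUnit a := by
  rw [Matrix.isUnit_iff_isUnit_det] at h ⊢
  apply isUnit_of_map_unit φ
  rwa [RingHom.map_det]

open Matrix in
theorem forward_aux {R S : Type*} [CommRing R] [CommRing S] (φ : R →+* S) [IsLocalHom φ]
    {n : ℕ} (w : Matrix (Fin n) (Fin n) R) (hw : w * w = 1)
    (hrev : ∀ (M : Matrix (Fin n) (Fin n) R) i j, (w * M * w) i j = M i.rev j.rev)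
    (A B C D : Matrix (Fin n) (Fin n) R)
    (hA : ∀ i j, j < i → φ (A i j) = 0) (hC : φ.mapMatrix C = 0)
    (hD : ∀ i j, j < i → φ (D i j) = 0) (hg : IsUnit (fromBlocks A B C D)) :
    ∃ (h₁ h₂ b₁ b₃ : GL (Fin n) R) (b₂ : Matrix (Fin n) (Fin n) R),
      φ.mapMatrix (h₁ : Matrix (Fin n) (Fin n) R) = 1 ∧ φ.mapMatrix (h₂ : Matrix (Fin n) (Fin n) R) = 1 ∧
      (∀ i j, j < i → (b₁ : Matrix (Fin n) (Fin n) R) i j = 0) ∧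
      (∀ i j, j < i → (b₃ : Matrix (Fin n) (Fin n) R) i j = 0) ∧
      A = h₁ * b₁ ∧ B = h₁ * b₂ ∧ C = (h₂ * w - w * h₁) * b₁ ∧
      D = (h₂ * w - w * h₁) * b₂ + h₂ * b₃ := by
  have hA' : IsUnit A := by
    rw [Matrix.isUnit_iff_isUnit_det] at hg ⊢
    have h1 := hg.map φ
    rw [RingHom.map_det] at h1
    have : φ.mapMatrix (fromBlocks A B C D) =
        fromBlocks (φ.mapMatrix A) (φ.mapMatrix B) 0 (φ.mapMatrix D) := by
      rw [← hC]; simp [Matrix.fromBlocks_map]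
    rw [this, Matrix.det_fromBlocks_zero₂₁, IsUnit.mul_iff, ← RingHom.map_det] at h1
    exact isUnit_of_map_unit φ _ h1.1
  obtain ⟨A, rfl⟩ := hA'
  obtain ⟨a, b₀, hab, -, ha, hb₀⟩ := lu_gl φ n A hA
  have hS : IsUnit (D - C * ((A⁻¹ : GL (Fin n) R) : Matrix (Fin n) (Fin n) R) * B) := by
    letI : Invertible (A : Matrix (Fin n) (Fin n) R) := A.isUnit.invertible
    rw [Matrix.isUnit_iff_isUnit_det] at hg ⊢
    rw [Matrix.det_fromBlocks₁₁, IsUnit.mul_iff] at hg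
    have := hg.2
    rwa [Matrix.invOf_eq_nonsing_inv, ← Matrix.coe_units_inv] at this
  obtain ⟨s, hs⟩ := hS
  have hww : φ.mapMatrix w * φ.mapMatrix w = 1 := by rw [← map_mul, hw, map_one]
  have hEm : φ.mapMatrix (C * ((b₀⁻¹ : GL (Fin n) R) : Matrix (Fin n) (Fin n) R) * w + w * a.val * w) = 1 := by
    simp only [map_add, map_mul, hC, ha, hww, zero_mul, zero_add, mul_one]
  obtain ⟨E, hE⟩ := unit_of_map φ _ (by rw [hEm]; exact isUnit_one)
  rw [← hE] at hEm
  have hEi := map_inv_one φ E hEm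
  have hsm : φ.mapMatrix (s : Matrix (Fin n) (Fin n) R) = φ.mapMatrix D := by
    rw [hs, map_sub, map_mul, map_mul, hC]; simp
  obtain ⟨L, b₃, hL, hLl, hL1, hb₃⟩ := lu_gl φ n (E⁻¹ * s) (by
    have : φ.mapMatrix ((E⁻¹ * s : GL (Fin n) R) : Matrix (Fin n) (Fin n) R) = φ.mapMatrix D := by
      rw [Units.val_mul, map_mul, hEi, hsm, one_mul]
    intro i j h
    have h2 := congrFun (congrFun this i) j
    simp only [RingHom.mapMatrix_apply, Matrix.map_apply] at h2
    rw [h2, hD i j h])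
  let W : GL (Fin n) R := ⟨w, w, hw, hw⟩
  have hW : (W : Matrix (Fin n) (Fin n) R) = w := rfl
  have hWi : W * W = 1 := Units.ext hw
  have ht : ∀ i j, j < i → ((W * L * W : GL (Fin n) R) : Matrix (Fin n) (Fin n) R) i j = 0 := by
    intro i j h
    rw [Units.val_mul, Units.val_mul, hW, hrev]
    exact hLl _ _ (Fin.rev_lt_rev.2 h)
  have htm : φ.mapMatrix ((W * L * W : GL (Fin n) R) : Matrix (Fin n) (Fin n) R) = 1 := by
    rw [Units.val_mul, Units.val_mul, hW, map_mul, map_mul, hL1, mul_one, hww]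
  have hLt : L = W * (W * L * W) * W := by
    rw [← mul_assoc, ← mul_assoc, hWi, one_mul, mul_assoc, hWi, mul_one]
  have hkey : E * L * b₃ = s := by rw [mul_assoc, ← hL]; group
  generalize W * L * W = t at ht htm hLt
  have hK : ((E * L : GL (Fin n) R) : Matrix (Fin n) (Fin n) R) * w - w * ((a * t : GL (Fin n) R) : Matrix (Fin n) (Fin n) R)
      = C * ((b₀⁻¹ * t : GL (Fin n) R) : Matrix (Fin n) (Fin n) R) := by
    have h1 : E * L * W = E * W * t := by
      rw [hLt, mul_assoc, mul_assoc, mul_assoc, mul_assoc, hWi, mul_one]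
    have h2 : ((E * L : GL (Fin n) R) : Matrix (Fin n) (Fin n) R) * w = E * w * t := by
      have := congrArg (Units.val) h1
      simpa [hW] using this
    rw [h2, hE, add_mul, mul_assoc, hw, mul_assoc (w * _), hw]
    simp only [Units.val_mul, add_mul, mul_one, mul_assoc]
    abel
  refine ⟨a * t, E * L, t⁻¹ * b₀, b₃, ((a * t)⁻¹ : GL (Fin n) R) * B, ?_, ?_, ?_, hb₃, ?_, ?_, ?_, ?_⟩
  · rw [Units.val_mul, map_mul, ha, htm, one_mul]
  · rw [Units.val_mul, map_mul, hEm, hL1, one_mul]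
  · rw [Units.val_mul]
    exact upper_mul _ _ (upper_inv t ht) hb₀
  · rw [hab, ← Units.val_mul]; congr 1; group
  · rw [Units.mul_inv_cancel_left]
  · rw [hK, mul_assoc, ← Units.val_mul]
    have : b₀⁻¹ * t * (t⁻¹ * b₀) = 1 := by group
    rw [this]; simp
  · rw [hK, mul_assoc, ← mul_assoc _ _ B, ← Units.val_mul, ← Units.val_mul, hkey, hs]
    have : b₀⁻¹ * t * (a * t)⁻¹ = A⁻¹ := by rw [hab]; group
    rw [this, ← mul_assoc]; abel

theorem wMat_rev (p n : ℕ) [Fact p.Prime] (i j : Fin n) :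
    wMat p n i j = if j = i.rev then 1 else 0 := by
  unfold wMat
  congr 1
  rw [Fin.ext_iff, Fin.val_rev]
  apply propext
  omega

theorem wMat_mul (p n : ℕ) [Fact p.Prime] (M : Matrix (Fin n) (Fin n) ℤ_[p]) (i j : Fin n) :
    (wMat p n * M) i j = M i.rev j := by
  simp [Matrix.mul_apply, wMat_rev]

theorem mul_wMat (p n : ℕ) [Fact p.Prime] (M : Matrix (Fin n) (Fin n) ℤ_[p]) (i j : Fin n) :
    (M * wMat p n) i j = M i j.rev := by
  simp [Matrix.mul_apply, wMat_rev, eq_comm (a := j), Fin.rev_eq_iff]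

theorem wMat_sq (p n : ℕ) [Fact p.Prime] : wMat p n * wMat p n = 1 := by
  ext i j
  rw [wMat_mul, wMat_rev]
  simp [Matrix.one_apply, eq_comm]

theorem uMat_inv (p n : ℕ) [Fact p.Prime] :
    (uMat p n)⁻¹ = Matrix.fromBlocks 1 0 (-wMat p n) 1 := by
  apply Matrix.inv_eq_left_inv
  simp [uMat, Matrix.fromBlocks_multiply]

theorem conj_eq (p n : ℕ) [Fact p.Prime] (h₁ h₂ : Matrix (Fin n) (Fin n) ℤ_[p]) :
    (uMat p n)⁻¹ * blockDiag p n h₁ h₂ * uMat p n =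
      Matrix.fromBlocks h₁ 0 (h₂ * wMat p n - wMat p n * h₁) h₂ := by
  rw [uMat_inv]
  simp [uMat, blockDiag, Matrix.fromBlocks_multiply, sub_eq_add_neg, add_comm]

/-- Box decomposition for `GL_{2n}` relative to
`H = GL_n × GL_n` and the torus of elements `(diag(y_1,…,y_n), diag(y_n,…,y_1))`,
on `ℤ_p`-points: `g` is upper triangular mod `p^r` iff `g = u⁻¹·diag(h₁,h₂)·u·b`
with `b` upper triangular, `h₁ ≡ diag(y_1,…,y_n)` and `h₂ ≡ diag(y_n,…,y_1)`
mod `p^r` for units `y_1, …, y_n`. -/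
theorem stmt7 (p : ℕ) [Fact p.Prime] (n r : ℕ) (hn : 1 ≤ n) (hr : 1 ≤ r)
    (g : GL (Fin n ⊕ Fin n) ℤ_[p]) :
    (∀ i j : Fin n ⊕ Fin n, ordIdx n j < ordIdx n i →
      (p : ℤ_[p]) ^ r ∣ (g : Matrix (Fin n ⊕ Fin n) (Fin n ⊕ Fin n) ℤ_[p]) i j) ↔
    (∃ (h₁ h₂ : GL (Fin n) ℤ_[p]) (y : Fin n → ℤ_[p]ˣ) (b : GL (Fin n ⊕ Fin n) ℤ_[p]),
      (∀ i j : Fin n, (p : ℤ_[p]) ^ r ∣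
        ((h₁ : Matrix (Fin n) (Fin n) ℤ_[p]) i j
          - Matrix.diagonal (fun k => (y k : ℤ_[p])) i j)) ∧
      (∀ i j : Fin n, (p : ℤ_[p]) ^ r ∣
        ((h₂ : Matrix (Fin n) (Fin n) ℤ_[p]) i j
          - Matrix.diagonal (fun k => (y k.rev : ℤ_[p])) i j)) ∧
      (∀ i j : Fin n ⊕ Fin n, ordIdx n j < ordIdx n i →
        (b : Matrix (Fin n ⊕ Fin n) (Fin n ⊕ Fin n) ℤ_[p]) i j = 0) ∧
      (g : Matrix (Fin n ⊕ Fin n) (Fin n ⊕ Fin n) ℤ_[p]) =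
        (uMat p n)⁻¹ *
          blockDiag p n (h₁ : Matrix (Fin n) (Fin n) ℤ_[p])
            (h₂ : Matrix (Fin n) (Fin n) ℤ_[p]) *
          uMat p n *
          (b : Matrix (Fin n ⊕ Fin n) (Fin n ⊕ Fin n) ℤ_[p])) := by
  have hloc : IsLocalHom (Ideal.Quotient.mk (Ideal.span {(p : ℤ_[p]) ^ r})) := by
    have hne : Nontrivial (ℤ_[p] ⧸ Ideal.span {(p : ℤ_[p]) ^ r}) := by
      rw [Ideal.Quotient.nontrivial_iff, Ne, Ideal.span_singleton_eq_top]
      intro h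
      have h2 := (isUnit_pow_iff (by omega)).1 h
      exact PadicInt.prime_p.not_isUnit h2
    exact IsLocalHom.of_surjective _ Ideal.Quotient.mk_surjective
  have hφ : ∀ x, (p : ℤ_[p]) ^ r ∣ x ↔ Ideal.Quotient.mk (Ideal.span {(p : ℤ_[p]) ^ r}) x = 0 := by
    intro x
    rw [Ideal.Quotient.eq_zero_iff_mem, Ideal.mem_span_singleton]
  simp only [hφ]
  generalize Ideal.Quotient.mk (Ideal.span {(p : ℤ_[p]) ^ r}) = φ at hloc
  clear hφ
  constructor
  · intro h
    obtain ⟨h₁, h₂, b₁, b₃, b₂, e₁, e₂, u₁, u₃, eA, eB, eC, eD⟩ := forward_aux φ (wMat p n)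
      (wMat_sq p n) (fun M i j => by rw [mul_wMat, wMat_mul])
      g.val.toBlocks₁₁ g.val.toBlocks₁₂ g.val.toBlocks₂₁ g.val.toBlocks₂₂
      (fun i j hij => h (Sum.inl i) (Sum.inl j) (by simpa [ordIdx] using hij))
      (by
        ext i j
        exact h (Sum.inr i) (Sum.inl j) (by simp [ordIdx]; omega))
      (fun i j hij => h (Sum.inr i) (Sum.inr j) (by simpa [ordIdx] using hij))
      (by rw [Matrix.fromBlocks_toBlocks]; exact g.isUnit)
    have hb : IsUnit (Matrix.fromBlocks (b₁ : Matrix (Fin n) (Fin n) ℤ_[p]) b₂ 0 b₃.val) := by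
      rw [Matrix.isUnit_iff_isUnit_det, Matrix.det_fromBlocks_zero₂₁, IsUnit.mul_iff,
        ← Matrix.isUnit_iff_isUnit_det, ← Matrix.isUnit_iff_isUnit_det]
      exact ⟨b₁.isUnit, b₃.isUnit⟩
    obtain ⟨b, hb⟩ := hb
    refine ⟨h₁, h₂, fun _ => 1, b, ?_, ?_, ?_, ?_⟩
    · intro i j
      have := congrFun (congrFun e₁ i) j
      simp only [RingHom.mapMatrix_apply, Matrix.map_apply] at this
      rw [map_sub, this]
      by_cases hij : i = j <;> simp [Matrix.one_apply, Matrix.diagonal_apply, hij]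
    · intro i j
      have := congrFun (congrFun e₂ i) j
      simp only [RingHom.mapMatrix_apply, Matrix.map_apply] at this
      rw [map_sub, this]
      by_cases hij : i = j <;> simp [Matrix.one_apply, Matrix.diagonal_apply, hij]
    · rw [hb]
      rintro (i | i) (j | j) hij
      · exact u₁ i j (by simpa [ordIdx] using hij)
      · simp [ordIdx] at hij; omega
      · rfl
      · exact u₃ i j (by simpa [ordIdx] using hij)
    · rw [conj_eq, hb, Matrix.fromBlocks_multiply, ← Matrix.fromBlocks_toBlocks g.val]
      congr 1
      · simpa using eA
      · simpa using eB
      · simpa using eC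
  · rintro ⟨h₁, h₂, y, b, e₁, e₂, hb, hg⟩ i j hij
    have key : φ.mapMatrix (Matrix.fromBlocks (h₁ : Matrix (Fin n) (Fin n) ℤ_[p]) 0
        (h₂.val * wMat p n - wMat p n * h₁.val) h₂.val) = Matrix.diagonal
          (Sum.elim (fun k => φ (y k)) (fun k : Fin n => φ (y k.rev))) := by
      simp only [map_sub, sub_eq_zero] at e₁ e₂
      ext (i | i) (j | j)
      · simp [e₁, Matrix.diagonal_apply, apply_ite φ]
      · simp
      · have hc : i = j.rev ↔ i.rev = j := Fin.rev_eq_iff.symm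
        simp [mul_wMat, wMat_mul, e₁, e₂, Matrix.diagonal_apply, hc]
      · simp [e₂, Matrix.diagonal_apply, apply_ite φ]
    rw [conj_eq] at hg
    have h2 := congrArg φ.mapMatrix hg
    rw [map_mul, key] at h2
    have h3 := congrFun (congrFun h2 i) j
    rw [Matrix.diagonal_mul] at h3
    simp only [RingHom.mapMatrix_apply, Matrix.map_apply] at h3
    rw [h3, hb i j hij]; simp
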